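/- arXiv:1606.04607 — 6 statements merged into one kernel-verified Lean document; each statement's English description precedes it below -/
import Mathlib

section
/- Let E be a finite directed graph with vertex set {v_1, ..., v_h}, listed so that the regular vertices appear as v_1, ..., v_z. If m and n are positive integers with m·[v_1 + ... + v_h] = n·[v_1 + ... + v_h] in M_E, then there exists an integer vector x ∈ ℤ^h with x_j = 0 for all j > z such that (A_E^t − J_E)·x = (m − n)·b. -/
open Finset

/-- The defining relations of the graph monoid of a finite graph with edge set `Ed`, source
map `s` and range map `r`: for each regular vertex `v` (one emitting at least one edge),
`v = ∑_{e ∈ s⁻¹(v)} r(e)` in the free commutative monoid on the vertices. -/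
def graphRel {V Ed : Type} [Fintype Ed] [DecidableEq V] (s r : Ed → V) :
    (V →₀ ℕ) → (V →₀ ℕ) → Prop := fun x y =>
  ∃ v : V, (∃ e, s e = v) ∧ x = Finsupp.single v 1 ∧
    y = ∑ e ∈ univ.filter (fun e => s e = v), Finsupp.single (r e) 1

/-- The congruence on the free commutative monoid on the vertices generated by the graph
relations; the graph monoid `M_E` is its quotient `(graphCon s r).Quotient`. -/
noncomputable def graphCon {V Ed : Type} [Fintype Ed] [DecidableEq V] (s r : Ed → V) :
    AddCon (V →₀ ℕ) := addConGen (graphRel s r)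

/-- The integer matrix `A_E^t − J_E`, for a graph with vertices `v_1, …, v_h` (indexed by
`Fin h`) whose regular vertices are `v_1, …, v_z`: the `(i,j)` entry is the number of edges
from `v_j` to `v_i`, minus `1` if `i = j` with `i` among the first `z` indices. -/
def tMinusJZ {Ed : Type} [Fintype Ed] (h z : ℕ) (s r : Ed → Fin h) :
    Matrix (Fin h) (Fin h) ℤ := Matrix.of fun i j =>
  ((univ.filter fun e => s e = j ∧ r e = i).card : ℤ) -
    (if i = j ∧ (i : ℕ) < z then 1 else 0)

/-- Elements of the free commutative monoid that agree in the graph monoid differ by an element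
of the image of `A_E^t − J_E` on integer vectors supported on the regular vertices. -/
theorem exists_mulVec_eq_sub_of_graphCon {Ed : Type} [Fintype Ed] {h z : ℕ} (s r : Ed → Fin h)
    (hreg : ∀ i : Fin h, (∃ e, s e = i) ↔ (i : ℕ) < z) {a b : Fin h →₀ ℕ}
    (hab : graphCon s r a b) :
    ∃ x : Fin h → ℤ, (∀ j : Fin h, z ≤ (j : ℕ) → x j = 0) ∧
      (tMinusJZ h z s r).mulVec x = fun i => (b i : ℤ) - (a i : ℤ) := by
  have hgen : AddConGen.Rel (graphRel s r) a b := hab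
  induction hgen with
  | of a b hrel =>
    obtain ⟨v, hv, rfl, rfl⟩ := hrel
    have hvz := (hreg v).1 hv
    refine ⟨Pi.single v 1, fun j hj => Pi.single_eq_of_ne (fun hjv => ?_) 1, ?_⟩
    · subst hjv
      omega
    · ext i
      rw [Matrix.mulVec_single_one]
      simp only [Matrix.col_apply, tMinusJZ, Matrix.of_apply, Finsupp.finsetSum_apply,
        Finsupp.single_apply]
      congr 1
      · rw [Finset.sum_boole, Finset.filter_filter]
        simp
      · by_cases hiv : i = v
        · subst hiv
          simp [hvz]
        · simp [hiv, Ne.symm hiv]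
  | refl a => exact ⟨0, by simp, by ext; simp⟩
  | symm hrel ih =>
    obtain ⟨x, hx, hxe⟩ := ih hrel
    refine ⟨-x, fun j hj => by simp [hx j hj], ?_⟩
    rw [Matrix.mulVec_neg, hxe]
    ext i
    simp
  | trans hrel₁ hrel₂ ih₁ ih₂ =>
    obtain ⟨x, hx, hxe⟩ := ih₁ hrel₁
    obtain ⟨y, hy, hye⟩ := ih₂ hrel₂
    refine ⟨x + y, fun j hj => by simp [hx j hj, hy j hj], ?_⟩
    rw [Matrix.mulVec_add, hxe, hye]
    ext i
    simp
  | add hrel₁ hrel₂ ih₁ ih₂ =>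
    obtain ⟨x, hx, hxe⟩ := ih₁ hrel₁
    obtain ⟨y, hy, hye⟩ := ih₂ hrel₂
    refine ⟨x + y, fun j hj => by simp [hx j hj, hy j hj], ?_⟩
    rw [Matrix.mulVec_add, hxe, hye]
    ext i
    simp only [Pi.add_apply, Finsupp.add_apply]
    push_cast
    ring

/-- Let `E` be a finite graph with vertices `{v_1, …, v_h}`, listed so that the regular
vertices appear as `v_1, …, v_z`.  If `m` and `n` are positive integers with
`m·[v_1 + ⋯ + v_h] = n·[v_1 + ⋯ + v_h]` in `M_E`, then there is an integer vector
`x ∈ ℤ^h` with `x_j = 0` for all `j > z` such that `(A_E^t − J_E)·x = (m − n)·b`,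
where `b` is the all-ones vector. -/
theorem stmt3 {Ed : Type} [Fintype Ed] {h z : ℕ} (s r : Ed → Fin h)
    (hreg : ∀ i : Fin h, (∃ e, s e = i) ↔ (i : ℕ) < z)
    (m n : ℕ) (hm : 0 < m) (hn : 0 < n)
    (heq : m • (graphCon s r).mk' (∑ v : Fin h, Finsupp.single v 1) =
      n • (graphCon s r).mk' (∑ v : Fin h, Finsupp.single v 1)) :
    ∃ x : Fin h → ℤ, (∀ j : Fin h, z ≤ (j : ℕ) → x j = 0) ∧
      (tMinusJZ h z s r).mulVec x = fun _ => (m : ℤ) - (n : ℤ) := by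
  rw [← map_nsmul, ← map_nsmul] at heq
  obtain ⟨x, hx, hxe⟩ := exists_mulVec_eq_sub_of_graphCon s r hreg
    ((graphCon s r).eq.1 heq.symm)
  refine ⟨x, hx, ?_⟩
  rw [hxe]
  ext i
  simp [Finsupp.single_apply]
end

section
/- Let E be a finite directed graph with vertex set {v_1, ..., v_h}, listed so that the regular vertices appear as v_1, ..., v_z. If there exist an integer vector x ∈ ℤ^h with x_j = 0 for all j > z and a nonzero integer c such that (A_E^t − J_E)·x = c·b, then there exist distinct positive integers m and n with m·[v_1 + ... + v_h] = n·[v_1 + ... + v_h] in M_E. -/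
open Finset

/-- One step of expansion at a vertex: a regular vertex is replaced by the sum of the ranges of
the edges it emits, a sink is left unchanged. -/
noncomputable def graphExpand {V Ed : Type} [Fintype Ed] [DecidableEq V] (s r : Ed → V) (v : V) :
    V →₀ ℕ :=
  open Classical in
  if ∃ e, s e = v then ∑ e ∈ univ.filter (fun e => s e = v), Finsupp.single (r e) 1
  else Finsupp.single v 1

theorem graphCon_mk'_graphExpand {V Ed : Type} [Fintype Ed] [DecidableEq V] (s r : Ed → V)
    (v : V) :
    (graphCon s r).mk' (graphExpand s r v) = (graphCon s r).mk' (Finsupp.single v 1) := by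
  unfold graphExpand
  split_ifs with hv
  · exact ((AddCon.eq _).2 (AddConGen.Rel.of _ _ ⟨v, hv, rfl, rfl⟩)).symm
  · rfl

theorem graphCon_mk'_sum_smul_graphExpand {V Ed : Type} [Fintype V] [Fintype Ed] [DecidableEq V]
    (s r : Ed → V) (y : V →₀ ℕ) :
    (graphCon s r).mk' (∑ v, y v • graphExpand s r v) = (graphCon s r).mk' y := by
  have hy : y = ∑ v, y v • Finsupp.single v 1 := by
    ext i
    simp
  conv_rhs => rw [hy]
  simp only [map_sum, map_nsmul, graphCon_mk'_graphExpand]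

theorem graphExpand_apply {Ed : Type} [Fintype Ed] {h z : ℕ} (s r : Ed → Fin h)
    (hreg : ∀ i : Fin h, (∃ e, s e = i) ↔ (i : ℕ) < z) (i j : Fin h) :
    (graphExpand s r j i : ℤ) = tMinusJZ h z s r i j + if i = j then 1 else 0 := by
  unfold graphExpand tMinusJZ
  by_cases hj : ∃ e, s e = j
  · have hz := (hreg j).1 hj
    have hij : (i = j ∧ (i : ℕ) < z) ↔ i = j := ⟨And.left, fun e => ⟨e, e ▸ hz⟩⟩
    simp [hj, hij, Finsupp.finsetSum_apply, Finsupp.single_apply,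
      Finset.filter_filter]
  · have hz := fun h' => hj ((hreg j).2 h')
    have hij : ¬ (i = j ∧ (i : ℕ) < z) := fun e => hz (e.1 ▸ e.2)
    have hs : (univ.filter fun e => s e = j ∧ r e = i) = ∅ :=
      Finset.filter_eq_empty_iff.2 fun e _ he => hj ⟨e, he.1⟩
    rw [if_neg hj, Matrix.of_apply, if_neg hij, hs]
    simp [Finsupp.single_apply, eq_comm]


/-- Let `E` be a finite graph with vertices `{v_1, …, v_h}`, listed so that the regular
vertices appear as `v_1, …, v_z`.  If there exist an integer vector `x ∈ ℤ^h` with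
`x_j = 0` for all `j > z` and a nonzero integer `c` such that `(A_E^t − J_E)·x = c·b`
(`b` the all-ones vector), then there exist distinct positive integers `m` and `n` with
`m·[v_1 + ⋯ + v_h] = n·[v_1 + ⋯ + v_h]` in `M_E`. -/
theorem stmt4 {Ed : Type} [Fintype Ed] {h z : ℕ} (s r : Ed → Fin h)
    (hreg : ∀ i : Fin h, (∃ e, s e = i) ↔ (i : ℕ) < z)
    (x : Fin h → ℤ) (hx : ∀ j : Fin h, z ≤ (j : ℕ) → x j = 0)
    (c : ℤ) (hc : c ≠ 0)
    (hsol : (tMinusJZ h z s r).mulVec x = fun _ => c) :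
    ∃ m n : ℕ, 0 < m ∧ 0 < n ∧ m ≠ n ∧
      m • (graphCon s r).mk' (∑ v : Fin h, Finsupp.single v 1) =
        n • (graphCon s r).mk' (∑ v : Fin h, Finsupp.single v 1) := by
  wlog hpos : 0 < c generalizing x c
  · refine this (-x) (fun j hj => by simp [hx j hj]) (-c) (neg_ne_zero.2 hc) ?_ (by omega)
    rw [Matrix.mulVec_neg, hsol]
    rfl
  lift c to ℕ using hpos.le
  set w : Fin h →₀ ℕ := ∑ v : Fin h, Finsupp.single v 1 with hw
  have hwv : ∀ i, w i = 1 := fun i => by simp [hw, Finsupp.finsetSum_apply, Finsupp.single_apply]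
  set N : ℕ := 1 + ∑ i, (x i).natAbs with hN
  have hxN : ∀ i, (x i).natAbs ≤ N := fun i =>
    (Finset.single_le_sum (f := fun i => (x i).natAbs) (fun _ _ => Nat.zero_le _)
      (Finset.mem_univ i)).trans (Nat.le_add_left _ _)
  set y : Fin h →₀ ℕ := Finsupp.equivFunOnFinite.symm fun i => (N + x i).toNat with hy
  have hyv : ∀ i, (y i : ℤ) = N + x i := fun i => by
    have := hxN i
    change (((N + x i).toNat : ℕ) : ℤ) = _
    omega
  have key : (∑ v, y v • graphExpand s r v) + N • w =
      (∑ v, (N • w) v • graphExpand s r v) + y + c • w := by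
    ext i
    have hi := congrFun hsol i
    simp only [Matrix.mulVec, dotProduct] at hi
    rw [← Nat.cast_inj (R := ℤ)]
    simp only [Finsupp.add_apply, Finsupp.finsetSum_apply, Finsupp.smul_apply, smul_eq_mul, hwv,
      mul_one]
    push_cast
    simp only [hyv, graphExpand_apply s r hreg, add_mul, mul_add, Finset.sum_add_distrib, mul_ite,
      mul_one, mul_zero, Finset.sum_ite_eq, Finset.mem_univ, if_true]
    rw [← hi]
    simp only [mul_comm (x _)]
    ring
  have hle : y ≤ (2 * N) • w := fun i => by
    have h1 := hyv i
    have h2 := hxN i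
    simp only [Finsupp.smul_apply, hwv, smul_eq_mul, mul_one]
    omega
  obtain ⟨t, ht⟩ := exists_add_of_le hle
  have hq := congrArg (graphCon s r).mk' key
  have htq := congrArg (graphCon s r).mk' ht
  simp only [map_add, graphCon_mk'_sum_smul_graphExpand, map_nsmul] at hq htq
  refine ⟨3 * N, 3 * N + c, by omega, by omega, by omega, ?_⟩
  have h3 : 3 * N = 2 * N + N := by ring
  rw [add_nsmul, h3, add_nsmul, htq, add_right_comm]
  conv_lhs => rw [hq]
  abel
end

section
/- Let E be a finite directed graph with nonempty vertex set, and let F(E) be the graph obtained from E by adding, for each regular vertex v, a new vertex v' and, for each edge e of E with r(e) regular, a new edge e' with s(e') = s(e) and r(e') = r(e)'. Then the graph monoid M_{F(E)} satisfies: for all positive integers m and n, m·[Σ_{w ∈ F(E)⁰} w] = n·[Σ_{w ∈ F(E)⁰} w] in M_{F(E)} implies m = n. -/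
open Finset

/-- The source map of the graph `F(E)`: the vertices of `F(E)` are the vertices of `E`
together with a new vertex `v'` for each regular vertex `v` of `E`, and the edges of `F(E)`
are the edges of `E` together with a new edge `e'` for each edge `e` of `E` whose range
is regular, where `s(e') = s(e)`. -/
def cohnS {V Ed : Type} (s r : Ed → V) :
    Ed ⊕ {e : Ed // ∃ e', s e' = r e} → V ⊕ {v : V // ∃ e, s e = v} :=
  Sum.elim (fun e => Sum.inl (s e)) (fun e => Sum.inl (s e.1))

/-- The range map of the graph `F(E)`: the new edge `e'` attached to an edge `e` of `E`
whose range `r(e)` is regular has range the new vertex `r(e)'`. -/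
def cohnR {V Ed : Type} (s r : Ed → V) :
    Ed ⊕ {e : Ed // ∃ e', s e' = r e} → V ⊕ {v : V // ∃ e, s e = v} :=
  Sum.elim (fun e => Sum.inl (r e)) (fun e => Sum.inr ⟨r e.1, e.2⟩)

/-- The additive map on the free commutative monoid on the vertices determined by integer
weights on the vertices. -/
noncomputable def weightHom {V : Type} (c : V → ℤ) : (V →₀ ℕ) →+ ℤ :=
  Finsupp.liftAddHom fun v => multiplesHom ℤ (c v)

@[simp]
theorem weightHom_single {V : Type} (c : V → ℤ) (v : V) :
    weightHom c (Finsupp.single v 1) = c v := by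
  simp [weightHom]

/-- Weights compatible with the graph relations are invariant under the graph congruence. -/
theorem weightHom_eq_of_mk'_eq {V Ed : Type} [Fintype Ed] [DecidableEq V] {s r : Ed → V}
    {c : V → ℤ}
    (hc : ∀ v, (∃ e, s e = v) → c v = ∑ e ∈ univ.filter (fun e => s e = v), c (r e))
    {x y : V →₀ ℕ} (h : (graphCon s r).mk' x = (graphCon s r).mk' y) :
    weightHom c x = weightHom c y := by
  have hle : graphCon s r ≤ AddCon.ker (weightHom c) := by
    refine AddCon.addConGen_le.2 ?_
    rintro _ _ ⟨v, hv, rfl, rfl⟩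
    simpa [AddCon.ker_rel, map_sum] using hc v hv
  exact hle ((AddCon.eq _).1 h)

/-- Weights on the vertices of the Cohn graph `F(E)`: a regular vertex `v` has weight its
out-degree in `E`, a sink has weight `1`, and the weights of `v` and `v'` add up to `1`. -/
noncomputable def cohnWeight {V Ed : Type} [Fintype Ed] [DecidableEq V] (s : Ed → V) :
    V ⊕ {v : V // ∃ e, s e = v} → ℤ :=
  Sum.elim
    (fun v => if ∃ e, s e = v then ((univ.filter fun e => s e = v).card : ℤ) else 1)
    (fun v => 1 - ((univ.filter fun e => s e = v.1).card : ℤ))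

theorem sum_coe_subtype_eq_sum_ite {α : Type} [Fintype α] {p : α → Prop} [DecidablePred p]
    (f : α → ℤ) : ∑ a : {a // p a}, f a = ∑ a, if p a then f a else 0 := by
  rw [← sum_filter]
  exact (sum_subtype _ (by simp) f).symm

theorem cohnWeight_eq_sum {V Ed : Type} [Fintype Ed] [DecidableEq V] (s r : Ed → V)
    (w : V ⊕ {v : V // ∃ e, s e = v}) (hw : ∃ e, cohnS s r e = w) :
    cohnWeight s w =
      ∑ e ∈ univ.filter (fun e => cohnS s r e = w), cohnWeight s (cohnR s r e) := by
  obtain ⟨v, hv, rfl⟩ : ∃ v, (∃ e, s e = v) ∧ w = Sum.inl v := by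
    obtain ⟨e | e, rfl⟩ := hw
    exacts [⟨s e, ⟨e, rfl⟩, rfl⟩, ⟨s e.1, ⟨e.1, rfl⟩, rfl⟩]
  rw [sum_filter, Fintype.sum_sum_type]
  simp only [cohnS, cohnR, cohnWeight, Sum.elim_inl, Sum.elim_inr, Sum.inl.injEq, if_pos hv]
  rw [sum_coe_subtype_eq_sum_ite fun e =>
      if s e = v then 1 - ((univ.filter fun e' => s e' = r e).card : ℤ) else 0,
    ← sum_add_distrib, card_filter]
  push_cast
  refine sum_congr rfl fun e _ => ?_
  split_ifs <;> simp

theorem sum_cohnWeight {V Ed : Type} [Fintype V] [Fintype Ed] [DecidableEq V] (s : Ed → V) :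
    ∑ w, cohnWeight s w = Fintype.card V := by
  rw [Fintype.sum_sum_type]
  simp only [cohnWeight, Sum.elim_inl, Sum.elim_inr]
  rw [sum_coe_subtype_eq_sum_ite fun v => 1 - ((univ.filter fun e => s e = v).card : ℤ),
    ← sum_add_distrib,
    Fintype.card_eq_sum_ones]
  push_cast
  refine sum_congr rfl fun v _ => ?_
  split_ifs <;> simp

/-- Let `E` be a finite graph with nonempty vertex set and let `F(E)` be its Cohn graph.
Then the graph monoid `M_{F(E)}` satisfies: for all positive integers `m` and `n`,
`m·[Σ_{w ∈ F(E)⁰} w] = n·[Σ_{w ∈ F(E)⁰} w]` in `M_{F(E)}` implies `m = n`. -/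
theorem stmt6 {V Ed : Type} [Fintype V] [Fintype Ed] [DecidableEq V] [Nonempty V]
    (s r : Ed → V) :
    ∀ m n : ℕ, 0 < m → 0 < n →
      m • (graphCon (cohnS s r) (cohnR s r)).mk'
          (∑ w : V ⊕ {v : V // ∃ e, s e = v}, Finsupp.single w 1) =
        n • (graphCon (cohnS s r) (cohnR s r)).mk'
          (∑ w : V ⊕ {v : V // ∃ e, s e = v}, Finsupp.single w 1) → m = n := by
  intro m n _ _ h
  rw [← map_nsmul, ← map_nsmul] at h
  have hmn := weightHom_eq_of_mk'_eq (cohnWeight_eq_sum s r) h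
  simp only [map_nsmul, map_sum, weightHom_single, sum_cohnWeight, nsmul_eq_mul] at hmn
  exact_mod_cast mul_right_cancel₀ (Nat.cast_ne_zero.2 Fintype.card_ne_zero) hmn
end

section
/- Let E be a finite directed graph with nonempty vertex set that contains a source cycle. Then the graph monoid M_E satisfies: for all positive integers m and n, m·[Σ_{v ∈ E⁰} v] = n·[Σ_{v ∈ E⁰} v] in M_E implies m = n. -/
open Finset

/-- A cycle in a graph with edge set `Ed`, source map `s` and range map `r`: a cyclic
sequence of edges `c_0, …, c_n` with `r(c_i) = s(c_{i+1})` (indices mod `n + 1`) which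
does not revisit any vertex. -/
def IsCycle {V Ed : Type} (s r : Ed → V) {n : ℕ} (c : Fin (n + 1) → Ed) : Prop :=
  (∀ i, r (c i) = s (c (i + 1))) ∧ Function.Injective (fun i => s (c i))

/-- A source cycle: a cycle such that every vertex on the cycle receives exactly one edge. -/
def IsSourceCycle {V Ed : Type} [Fintype Ed] [DecidableEq V] (s r : Ed → V) {n : ℕ}
    (c : Fin (n + 1) → Ed) : Prop :=
  IsCycle s r c ∧ ∀ i, (univ.filter fun e => r e = s (c i)).card = 1

/-- An edge ends on a source cycle if and only if it is an edge of that cycle. -/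
theorem IsSourceCycle.mem_range_iff {V Ed : Type} [Fintype Ed] [DecidableEq V] {s r : Ed → V}
    {n : ℕ} {c : Fin (n + 1) → Ed} (h : IsSourceCycle s r c) (e : Ed) :
    (∃ i, s (c i) = r e) ↔ ∃ i, c i = e := by
  constructor
  · rintro ⟨i, hi⟩
    refine ⟨i - 1, card_le_one.1 (h.2 i).le _ ?_ _ ?_⟩
    · simp [h.1.1 (i - 1)]
    · simp [hi]
  · rintro ⟨i, rfl⟩
    exact ⟨i + 1, (h.1.1 i).symm⟩

/-- A vertex emits exactly one edge ending on a source cycle if it lies on that cycle, and none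
otherwise. -/
theorem IsSourceCycle.sum_indicator {V Ed : Type} [Fintype Ed] [DecidableEq V] {s r : Ed → V}
    {n : ℕ} {c : Fin (n + 1) → Ed} (h : IsSourceCycle s r c) (v : V) :
    ∑ e ∈ univ.filter (fun e => s e = v), (if ∃ i, s (c i) = r e then 1 else 0) =
      if ∃ i, s (c i) = v then 1 else 0 := by
  rw [← card_filter, filter_filter]
  split_ifs with hv
  · obtain ⟨i, rfl⟩ := hv
    rw [card_eq_one]
    refine ⟨c i, ?_⟩
    ext e
    simp only [mem_filter, mem_univ, true_and, mem_singleton, h.mem_range_iff]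
    constructor
    · rintro ⟨he, j, rfl⟩
      rw [h.1.2 he]
    · rintro rfl
      exact ⟨rfl, i, rfl⟩
  · rw [card_eq_zero, filter_eq_empty_iff]
    rintro e - ⟨he, hr⟩
    obtain ⟨i, rfl⟩ := (h.mem_range_iff e).1 hr
    exact hv ⟨i, he⟩

/-- A vertex weight which respects the graph relations takes the same total value on elements
with the same class in the graph monoid. -/
theorem graphCon_le_ker {V Ed : Type} [Fintype Ed] [DecidableEq V] {s r : Ed → V} {f : V → ℕ}
    (hf : ∀ v, ∑ e ∈ univ.filter (fun e => s e = v), f (r e) = f v) :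
    graphCon s r ≤ AddCon.ker (Finsupp.weight f) := by
  refine AddCon.addConGen_le.2 ?_
  rintro x y ⟨v, -, rfl, rfl⟩
  simp [AddCon.ker_rel, Finsupp.weight_single, hf]

/-- Let `E` be a finite graph with nonempty vertex set that contains a source cycle.
Then the graph monoid `M_E` satisfies: for all positive integers `m` and `n`,
`m·[Σ_{v ∈ E⁰} v] = n·[Σ_{v ∈ E⁰} v]` in `M_E` implies `m = n`. -/
theorem stmt8 {V Ed : Type} [Fintype V] [Fintype Ed] [DecidableEq V] [Nonempty V]
    (s r : Ed → V)
    (hcycle : ∃ (n : ℕ) (c : Fin (n + 1) → Ed), IsSourceCycle s r c) :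
    ∀ m n : ℕ, 0 < m → 0 < n →
      m • (graphCon s r).mk' (∑ v : V, Finsupp.single v 1) =
        n • (graphCon s r).mk' (∑ v : V, Finsupp.single v 1) → m = n := by
  obtain ⟨k, c, hc⟩ := hcycle
  intro m n _ _ h
  rw [← map_nsmul, ← map_nsmul] at h
  have hw := graphCon_le_ker
    (f := fun v => if ∃ i, s (c i) = v then 1 else 0) hc.sum_indicator ((AddCon.eq _).1 h)
  rw [AddCon.ker_rel, map_nsmul, map_nsmul, smul_eq_mul, smul_eq_mul] at hw
  refine Nat.eq_of_mul_eq_mul_right ?_ hw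
  simp only [map_sum, Finsupp.weight_single, one_smul]
  exact sum_pos' (fun _ _ => Nat.zero_le _) ⟨s (c 0), mem_univ _, by simp⟩
end

section
/- Let E be a finite directed graph with nonempty vertex set such that every vertex receives at least one edge (E is source-free) and such that no two distinct cycles of E have a common vertex (any two cycles sharing a vertex have the same set of edges). Then E contains a source cycle. -/
open Finset

open Relation in
/-- A walk from `r e` to `b`, prefixed with the edge `e`, as a sequence of edges. -/
lemma exists_walk_of_reflTransGen {V Ed : Type} (s r : Ed → V) (e : Ed) {b : V}
    (h : ReflTransGen (fun u v => ∃ e, s e = u ∧ r e = v) (r e) b) :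
    ∃ (n : ℕ) (f : ℕ → Ed), f 0 = e ∧ (∀ i < n, r (f i) = s (f (i + 1))) ∧ r (f n) = b := by
  induction h with
  | refl => exact ⟨0, fun _ => e, rfl, by simp, rfl⟩
  | tail _ hbc ih =>
    obtain ⟨n, f, h0, hf, hn⟩ := ih
    obtain ⟨e', hs, hr⟩ := hbc
    refine ⟨n + 1, fun k => if k ≤ n then f k else e', by simpa using h0, fun i hi => ?_,
      by simpa using hr⟩
    have hin : i ≤ n := by lia
    rcases hin.lt_or_eq with h | rfl
    · simpa [hin, Nat.succ_le_of_lt h] using hf i h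
    · simp [hn, hs]

open Relation in
/-- If the source of `e` can be reached from its range, then `e` lies on a cycle. -/
lemma exists_isCycle_of_reflTransGen {V Ed : Type} (s r : Ed → V) (e : Ed)
    (h : ReflTransGen (fun u v => ∃ e, s e = u ∧ r e = v) (r e) (s e)) :
    ∃ (n : ℕ) (c : Fin (n + 1) → Ed), IsCycle s r c ∧ e ∈ Set.range c := by
  classical
  have hex := exists_walk_of_reflTransGen s r e h
  obtain ⟨f, h0, hf, hn⟩ := Nat.find_spec hex
  have hmin := fun m => Nat.find_min hex (m := m)
  generalize Nat.find hex = n at *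
  have hne : ∀ i j, i < j → j ≤ n → s (f i) ≠ s (f j) := by
    intro i j hij hj heq
    rcases Nat.eq_zero_or_pos i with rfl | hi
    · refine hmin (j - 1) (by lia) ⟨f, h0, fun k hk => hf k (by lia), ?_⟩
      rw [hf _ (by lia), Nat.sub_add_cancel hij, ← heq, h0]
    · refine hmin (n - (j - i)) (by lia)
        ⟨fun k => if k < i then f k else f (k + (j - i)), by simp [hi, h0], fun k hk => ?_, ?_⟩
      · rcases lt_trichotomy (k + 1) i with hk' | hk' | hk'
        · simpa [hk', (Nat.lt_succ_self k).trans hk'] using hf k (by lia)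
        · have hki : k < i := by lia
          have hji : k + 1 + (j - i) = j := by lia
          simp only [hki, hk'.not_lt, if_true, if_false, hji]
          rw [hf k (by lia), hk', heq]
        · have hk1 : ¬ k < i := by lia
          have hk2 : ¬ k + 1 < i := by lia
          simp only [hk1, hk2, if_false]
          rw [hf _ (by lia), Nat.add_right_comm]
      · have h1 : ¬ n - (j - i) < i := by lia
        have h2 : n - (j - i) + (j - i) = n := by lia
        simp only [h1, if_false, h2, hn]
  refine ⟨n, fun i => f i, ⟨fun i => ?_, fun i j hij => ?_⟩, 0, by simpa using h0⟩
  · rcases eq_or_ne i (Fin.last n) with rfl | hi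
    · simpa [h0] using hn
    · have hlt : i < Fin.last n := Fin.lt_last_iff_ne_last.mpr hi
      simpa only [Fin.val_add_one_of_lt hlt] using hf i hlt
  · rcases lt_trichotomy i j with h' | h' | h'
    · exact absurd hij (hne i j h' (by lia))
    · exact h'
    · exact absurd hij.symm (hne j i h' (by lia))

open Relation in
/-- Any vertex of a cycle can be reached from any other one. -/
lemma IsCycle.reflTransGen {V Ed : Type} {s r : Ed → V} {n : ℕ} {c : Fin (n + 1) → Ed}
    (hc : IsCycle s r c) (i j : Fin (n + 1)) :
    ReflTransGen (fun u v => ∃ e, s e = u ∧ r e = v) (s (c i)) (s (c j)) := by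
  have key : ∀ k : Fin (n + 1), ReflTransGen (fun u v => ∃ e, s e = u ∧ r e = v)
      (s (c i)) (s (c (i + k))) := by
    intro k
    induction k using Fin.induction with
    | zero => simpa using ReflTransGen.refl
    | succ k ih =>
      refine ih.tail ⟨_, rfl, ?_⟩
      rw [hc.1, add_assoc, Fin.coeSucc_eq_succ]
  simpa using key (j - i)

open Relation in
/-- In a nonempty finite type, every relation has an initial strongly connected component. -/
lemma exists_forall_reflTransGen_symm {V : Type*} [Finite V] [Nonempty V] (R : V → V → Prop) :
    ∃ v, ∀ u, ReflTransGen R u v → ReflTransGen R v u := by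
  obtain ⟨v, hv⟩ := Finite.exists_min fun v => {u | ReflTransGen R u v}.ncard
  refine ⟨v, fun u hu => ?_⟩
  have hsub : {w | ReflTransGen R w u} ⊆ {w | ReflTransGen R w v} := fun w hw => hw.trans hu
  have heq := Set.eq_of_subset_of_ncard_le hsub (hv u)
  exact heq.symm.subset (ReflTransGen.refl : ReflTransGen R v v)

/-- Let `E` be a finite graph with nonempty vertex set such that every vertex receives at
least one edge (`E` is source-free) and such that no two distinct cycles of `E` have a
common vertex (any two cycles sharing a vertex have the same set of edges).  Then `E`
contains a source cycle. -/
theorem stmt9 {V Ed : Type} [Fintype V] [Fintype Ed] [DecidableEq V] [Nonempty V]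
    (s r : Ed → V)
    (hsf : ∀ v : V, ∃ e, r e = v)
    (hdisj : ∀ (n m : ℕ) (c : Fin (n + 1) → Ed) (d : Fin (m + 1) → Ed),
      IsCycle s r c → IsCycle s r d → (∃ i j, s (c i) = s (d j)) →
        Set.range c = Set.range d) :
    ∃ (n : ℕ) (c : Fin (n + 1) → Ed), IsSourceCycle s r c := by
  obtain ⟨v, hv⟩ := exists_forall_reflTransGen_symm fun u v => ∃ e, s e = u ∧ r e = v
  have hcyc : ∀ e, Relation.ReflTransGen (fun u v => ∃ e, s e = u ∧ r e = v) (r e) v →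
      ∃ (n : ℕ) (c : Fin (n + 1) → Ed), IsCycle s r c ∧ e ∈ Set.range c := fun e he =>
    exists_isCycle_of_reflTransGen s r e (he.trans (hv _ (he.head ⟨e, rfl, rfl⟩)))
  obtain ⟨e, rfl⟩ := hsf v
  obtain ⟨n, c, hc, j, rfl⟩ := hcyc e .refl
  refine ⟨n, c, hc, fun i => Finset.card_eq_one.mpr ⟨c (i - 1), ?_⟩⟩
  ext e
  simp only [mem_filter, mem_univ, true_and, mem_singleton]
  constructor
  · intro he
    obtain ⟨m, d, hd, k, rfl⟩ := hcyc e (by rw [he, hc.1]; exact hc.reflTransGen _ _)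
    obtain ⟨l, hl⟩ : d k ∈ Set.range c := by
      rw [hdisj n m c d hc hd ⟨i, k + 1, by rw [← he, hd.1]⟩]
      exact ⟨k, rfl⟩
    rw [← hl, hc.1] at he
    rw [← hl, ← hc.2 he, add_sub_cancel_right]
  · rintro rfl
    rw [hc.1, sub_add_cancel]
end

section
/- Let E be the finite directed graph with vertices v_1, v_2, v_3 and edges consisting of two loops at v_1, one edge from v_1 to v_2, one loop at v_2, and one edge from v_2 to v_3. Then in the graph monoid M_E one has [v_1 + v_2 + v_3] = 2·[v_1 + v_2 + v_3]; in particular, M_E does not satisfy the condition that m·[v_1 + v_2 + v_3] = n·[v_1 + v_2 + v_3] implies m = n for positive integers m, n. -/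
open Finset

/-- Source map of the graph `E` with vertices `v₁, v₂, v₃` (namely `0, 1, 2 : Fin 3`) and
five edges: two loops at `v₁`, one edge `v₁ → v₂`, one loop at `v₂`, one edge `v₂ → v₃`. -/
def sE : Fin 5 → Fin 3 := ![0, 0, 0, 1, 1]

/-- Range map of the graph `E` with vertices `v₁, v₂, v₃` and five edges: two loops at
`v₁`, one edge `v₁ → v₂`, one loop at `v₂`, one edge `v₂ → v₃`. -/
def rE : Fin 5 → Fin 3 := ![0, 0, 1, 1, 2]

/-- The defining relation of the graph monoid at a regular vertex. -/
theorem graphCon_mk'_single {V Ed : Type} [Fintype Ed] [DecidableEq V] (s r : Ed → V) {v : V}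
    (hv : ∃ e, s e = v) :
    (graphCon s r).mk' (Finsupp.single v 1) =
      ∑ e ∈ univ.filter (fun e => s e = v), (graphCon s r).mk' (Finsupp.single (r e) 1) := by
  rw [← map_sum]
  exact (AddCon.eq _).2 (AddConGen.Rel.of _ _ ⟨v, hv, rfl, rfl⟩)

/-- For the graph `E` with two loops at `v₁`, an edge `v₁ → v₂`, a loop at `v₂` and an edge
`v₂ → v₃`, one has `[v₁ + v₂ + v₃] = 2·[v₁ + v₂ + v₃]` in the graph monoid `M_E`; in
particular `M_E` does not satisfy the condition that `m·[v₁ + v₂ + v₃] = n·[v₁ + v₂ + v₃]`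
implies `m = n` for positive integers `m, n`. -/
theorem stmt11 :
    (graphCon sE rE).mk' (∑ v : Fin 3, Finsupp.single v 1) =
        2 • (graphCon sE rE).mk' (∑ v : Fin 3, Finsupp.single v 1) ∧
      ¬ (∀ m n : ℕ, 0 < m → 0 < n →
          m • (graphCon sE rE).mk' (∑ v : Fin 3, Finsupp.single v 1) =
            n • (graphCon sE rE).mk' (∑ v : Fin 3, Finsupp.single v 1) → m = n) := by
  have key : (graphCon sE rE).mk' (∑ v : Fin 3, Finsupp.single v 1) =
      2 • (graphCon sE rE).mk' (∑ v : Fin 3, Finsupp.single v 1) := by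
    let π := fun v : Fin 3 => (graphCon sE rE).mk' (Finsupp.single v 1)
    have h₀ : π 0 = π 0 + π 0 + π 1 := by
      refine (graphCon_mk'_single sE rE (v := 0) ⟨0, rfl⟩).trans ?_
      rw [show univ.filter (fun e => sE e = 0) = {0, 1, 2} by decide,
        sum_insert (by decide), sum_insert (by decide), sum_singleton, ← add_assoc]
      rfl
    have h₁ : π 1 = π 1 + π 2 := by
      refine (graphCon_mk'_single sE rE (v := 1) ⟨3, rfl⟩).trans ?_
      rw [show univ.filter (fun e => sE e = 1) = {3, 4} by decide,
        sum_insert (by decide), sum_singleton]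
      rfl
    rw [map_sum, Fin.sum_univ_three]
    change π 0 + π 1 + π 2 = 2 • (π 0 + π 1 + π 2)
    generalize π 0 = a at *
    generalize π 1 = b at *
    generalize π 2 = c at *
    calc a + b + c = a + (b + c) := add_assoc _ _ _
      _ = a + b := by rw [← h₁]
      _ = (a + a + b) + b := by rw [← h₀]
      _ = (a + a + (b + c)) + (b + c) := by rw [← h₁]
      _ = 2 • (a + b + c) := by rw [two_nsmul]; abel
  exact ⟨key, fun h => absurd (h 1 2 one_pos two_pos (by rwa [one_nsmul])) (by decide)⟩
end
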